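/- arXiv:1003.0656 — 2 statements merged into one kernel-verified Lean document; each statement's English description precedes it below -/
import Mathlib

section
/- Let a,b,c,d,e,f,g,h ∈ ℝ and let A₁ be the 6×6 real matrix with rows (0,0,a,b,c,d), (0,0,e,f,g,h), (−f,b,0,0,0,0), (e,−a,0,0,0,0), (−h,d,0,0,0,0), (g,−c,0,0,0,0). Then the characteristic polynomial of A₁ is λ²·(λ² − Δ)², where Δ = be − af + dg − ch. In particular, the eigenvalues of A₁ are 0 (with multiplicity 2) and ±√Δ (each with multiplicity 2), and if Δ < 0 they are 0 and two pairs of purely imaginary conjugate eigenvalues ±i√(−Δ). -/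
open Matrix Polynomial

lemma aux_mult (x : ℂ) (p q : ℂ[X]) (hp : p = (X - C x) ^ 2 * q) (hq : q.eval x ≠ 0) :
    p.rootMultiplicity x = 2 := by
  have hq0 : q ≠ 0 := by
    rintro rfl
    simp at hq
  have h1 : (X - C x) ^ 2 * q ≠ 0 := mul_ne_zero (pow_ne_zero _ (X_sub_C_ne_zero x)) hq0
  rw [hp, rootMultiplicity_mul h1, rootMultiplicity_X_sub_C_pow,
    rootMultiplicity_eq_zero (p := q) (x := x) hq]

/-- The characteristic polynomial of the linear part `A₁` of an
`R₁`-reversible Hamiltonian vector field on `ℝ⁶` (case `dim Fix(R₁) = 2`) is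
`λ²(λ² - Δ)²` with `Δ = be - af + dg - ch`; in particular its eigenvalues are `0`
(multiplicity 2) and, when `Δ < 0`, the two purely imaginary pairs `±i√(-Δ)`
(each multiplicity 2). -/
theorem charpoly_case_6_2
    (a b c d e f g h : ℝ) (Δ : ℝ) (hΔ : Δ = b * e - a * f + d * g - c * h)
    (A₁ : Matrix (Fin 6) (Fin 6) ℝ)
    (hA : A₁ = !![0, 0, a, b, c, d;
                  0, 0, e, f, g, h;
                  -f, b, 0, 0, 0, 0;
                  e, -a, 0, 0, 0, 0;
                  -h, d, 0, 0, 0, 0;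
                  g, -c, 0, 0, 0, 0]) :
    A₁.charpoly = X ^ 2 * (X ^ 2 - C Δ) ^ 2 ∧
    (Δ < 0 →
      (∀ μ : ℂ, (A₁.charpoly.map (algebraMap ℝ ℂ)).IsRoot μ ↔
        (μ = 0 ∨ μ = Complex.I * (Real.sqrt (-Δ) : ℂ) ∨
          μ = -(Complex.I * (Real.sqrt (-Δ) : ℂ)))) ∧
      (A₁.charpoly.map (algebraMap ℝ ℂ)).rootMultiplicity 0 = 2 ∧
      (A₁.charpoly.map (algebraMap ℝ ℂ)).rootMultiplicity
        (Complex.I * (Real.sqrt (-Δ) : ℂ)) = 2 ∧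
      (A₁.charpoly.map (algebraMap ℝ ℂ)).rootMultiplicity
        (-(Complex.I * (Real.sqrt (-Δ) : ℂ))) = 2) := by
  have key : A₁.charpoly = X ^ 2 * (X ^ 2 - C Δ) ^ 2 := by
    subst hA hΔ
    rw [Matrix.charpoly]
    have hm : Matrix.charmatrix (!![0, 0, a, b, c, d;
                  0, 0, e, f, g, h;
                  -f, b, 0, 0, 0, 0;
                  e, -a, 0, 0, 0, 0;
                  -h, d, 0, 0, 0, 0;
                  g, -c, 0, 0, 0, 0] : Matrix (Fin 6) (Fin 6) ℝ) =
        !![X, 0, -C a, -C b, -C c, -C d;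
           0, X, -C e, -C f, -C g, -C h;
           C f, -C b, X, 0, 0, 0;
           -C e, C a, 0, X, 0, 0;
           C h, -C d, 0, 0, X, 0;
           -C g, C c, 0, 0, 0, X] := by
      ext1 i j
      fin_cases i <;> fin_cases j <;> simp [Matrix.charmatrix_apply]
    rw [hm]
    simp [Matrix.det_succ_row_zero, Fin.sum_univ_succ, Fin.succAbove]
    ring
  refine ⟨key, fun hneg => ?_⟩
  set w : ℂ := Complex.I * (Real.sqrt (-Δ) : ℂ) with hw
  have hw2 : w ^ 2 = (Δ : ℂ) := by
    have : ((Real.sqrt (-Δ) : ℝ) : ℂ) ^ 2 = ((-Δ : ℝ) : ℂ) := by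
      rw [← Complex.ofReal_pow, Real.sq_sqrt (by linarith)]
    rw [hw, mul_pow, this, Complex.I_sq]
    push_cast
    ring
  have hw0 : w ≠ 0 := by
    intro h0
    rw [h0] at hw2
    have : Δ = 0 := by
      have h3 : (Δ : ℂ) = 0 := by rw [← hw2]; simp
      exact_mod_cast h3
    linarith
  have hp : A₁.charpoly.map (algebraMap ℝ ℂ) = X ^ 2 * (X ^ 2 - C (w ^ 2)) ^ 2 := by
    rw [key, hw2]
    simp
  rw [hp]
  refine ⟨fun μ => ?_, ?_, ?_, ?_⟩
  · have : μ ^ 2 - w ^ 2 = (μ - w) * (μ + w) := by ring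
    simp [IsRoot.def, this, sub_eq_zero, add_eq_zero_iff_eq_neg]
  · refine aux_mult 0 _ ((X ^ 2 - C (w ^ 2)) ^ 2) (by simp) (by simp [hw0])
  · refine aux_mult w _ (X ^ 2 * (X + C w) ^ 2) (by simp only [C_pow]; ring) ?_
    have : w + w ≠ 0 := by rw [← two_mul]; exact mul_ne_zero two_ne_zero hw0
    simp [hw0]
  · refine aux_mult (-w) _ (X ^ 2 * (X - C w) ^ 2) (by simp only [C_pow, C_neg]; ring) ?_
    have : -w - w ≠ 0 := by
      have : -w - w = (-2) * w := by ring
      rw [this]; exact mul_ne_zero (by norm_num) hw0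
    simp [hw0, this]
end

section
/- Fix a, b ∈ ℝ, α > 0 and β ≠ 0, and consider the vector field X on ℝ⁶ (coordinates (x₁,y₁,x₂,y₂,x₃,y₃)) given by: ẋ₁ = −(b α²/β)(x₃y₂ − x₂y₃); ẏ₁ = (a α²/β)(x₃y₂ − x₂y₃); ẋ₂ = (α − a x₁ − b y₁)·y₂; ẏ₂ = −(α − a x₁ − b y₁)·x₂; ẋ₃ = (α − a x₁ − b y₁)·y₃; ẏ₃ = −(α − a x₁ − b y₁)·x₃. Then for all constants c₁, c₂ ∈ ℝ with ω := α − a c₁ − b c₂ ≠ 0 and every r > 0, the curve γ(t) = (c₁, c₂, r·sin(ωt), r·cos(ωt), 0, 0) is a periodic solution of X with period 2π/ω, and likewise γ̃(t) = (c₁, c₂, 0, 0, r·sin(ωt), r·cos(ωt)) is a periodic solution with period 2π/ω. In particular X possesses two 2-parameter families of periodic solutions which, as (c₁,c₂,r) → (0,0,0), terminate at the equilibrium at the origin with periods tending to 2π/α. -/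
open Matrix Real Filter Topology

/-- The `R₂`-reversible Birkhoff–Belitskii normal form (truncated at second order) of a
reversible Hamiltonian vector field with three degrees of freedom, case
`dim Fix(R₂) = 4`; coordinates `(x₁,y₁,x₂,y₂,x₃,y₃) = (z 0, …, z 5)`. -/
noncomputable def Xnf (a b α β : ℝ) (z : Fin 6 → ℝ) : Fin 6 → ℝ :=
  ![-(b * α ^ 2 / β) * (z 4 * z 3 - z 2 * z 5),
    (a * α ^ 2 / β) * (z 4 * z 3 - z 2 * z 5),
    (α - a * z 0 - b * z 1) * z 3,
    -((α - a * z 0 - b * z 1) * z 2),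
    (α - a * z 0 - b * z 1) * z 5,
    -((α - a * z 0 - b * z 1) * z 4)]

/-- First family: circles of radius `r` in the `(x₂,y₂)`-plane over the equilibrium
point `(c₁,c₂)` of the `(x₁,y₁)`-plane, of frequency `ω = α - a c₁ - b c₂`. -/
noncomputable def γfam (a b α c₁ c₂ r t : ℝ) : Fin 6 → ℝ :=
  ![c₁, c₂, r * Real.sin ((α - a * c₁ - b * c₂) * t),
    r * Real.cos ((α - a * c₁ - b * c₂) * t), 0, 0]

/-- Second family: circles of radius `r` in the `(x₃,y₃)`-plane. -/
noncomputable def γfam' (a b α c₁ c₂ r t : ℝ) : Fin 6 → ℝ :=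
  ![c₁, c₂, 0, 0, r * Real.sin ((α - a * c₁ - b * c₂) * t),
    r * Real.cos ((α - a * c₁ - b * c₂) * t)]

/-- The truncated normal form of the case `6:4` possesses two
`2`-parameter families of periodic solutions of period `2π/(α - a c₁ - b c₂)`, which
terminate at the origin with periods tending to `2π/α` as `(c₁,c₂,r) → 0`. -/
theorem two_parameter_families_case_6_4
    (a b α β : ℝ) (hα : 0 < α) (hβ : β ≠ 0) :
    (∀ c₁ c₂ r : ℝ, α - a * c₁ - b * c₂ ≠ 0 → 0 < r →
      (∀ t, deriv (γfam a b α c₁ c₂ r) t = Xnf a b α β (γfam a b α c₁ c₂ r t)) ∧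
      (∀ t, γfam a b α c₁ c₂ r (t + 2 * π / (α - a * c₁ - b * c₂)) =
        γfam a b α c₁ c₂ r t)) ∧
    (∀ c₁ c₂ r : ℝ, α - a * c₁ - b * c₂ ≠ 0 → 0 < r →
      (∀ t, deriv (γfam' a b α c₁ c₂ r) t = Xnf a b α β (γfam' a b α c₁ c₂ r t)) ∧
      (∀ t, γfam' a b α c₁ c₂ r (t + 2 * π / (α - a * c₁ - b * c₂)) =
        γfam' a b α c₁ c₂ r t)) ∧
    Tendsto (fun p : ℝ × ℝ => 2 * π / (α - a * p.1 - b * p.2)) (𝓝 0) (𝓝 (2 * π / α)) ∧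
    (∀ t, Tendsto (fun p : ℝ × ℝ × ℝ => γfam a b α p.1 p.2.1 p.2.2 t) (𝓝 0) (𝓝 0)) ∧
    (∀ t, Tendsto (fun p : ℝ × ℝ × ℝ => γfam' a b α p.1 p.2.1 p.2.2 t) (𝓝 0) (𝓝 0)) := by
  have hs : ∀ ω r t : ℝ, HasDerivAt (fun t => r * Real.sin (ω * t)) (ω * (r * Real.cos (ω * t))) t := by
    intro ω r t
    have h := (((hasDerivAt_id t).const_mul ω).sin).const_mul r
    exact h.congr_deriv (by simp only [id, mul_one]; ring)
  have hc : ∀ ω r t : ℝ, HasDerivAt (fun t => r * Real.cos (ω * t)) (-(ω * (r * Real.sin (ω * t)))) t := by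
    intro ω r t
    have h := (((hasDerivAt_id t).const_mul ω).cos).const_mul r
    exact h.congr_deriv (by simp only [id, mul_one]; ring)
  refine ⟨?_, ?_, ?_, ?_, ?_⟩
  · intro c₁ c₂ r hω hr
    refine ⟨fun t => HasDerivAt.deriv ?_, fun t => ?_⟩
    · rw [hasDerivAt_pi]
      intro i
      fin_cases i
      · simpa [γfam, Xnf] using hasDerivAt_const t c₁
      · simpa [γfam, Xnf] using hasDerivAt_const t c₂
      · simpa [γfam, Xnf] using hs (α - a * c₁ - b * c₂) r t
      · simpa [γfam, Xnf] using hc (α - a * c₁ - b * c₂) r t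
      · simpa [γfam, Xnf] using hasDerivAt_const t (0 : ℝ)
      · simpa [γfam, Xnf] using hasDerivAt_const t (0 : ℝ)
    · simp only [γfam, mul_add, mul_div_cancel₀ _ hω, Real.sin_add_two_pi, Real.cos_add_two_pi]
  · intro c₁ c₂ r hω hr
    refine ⟨fun t => HasDerivAt.deriv ?_, fun t => ?_⟩
    · rw [hasDerivAt_pi]
      intro i
      fin_cases i
      · simpa [γfam', Xnf] using hasDerivAt_const t c₁
      · simpa [γfam', Xnf] using hasDerivAt_const t c₂
      · simpa [γfam', Xnf] using hasDerivAt_const t (0 : ℝ)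
      · simpa [γfam', Xnf] using hasDerivAt_const t (0 : ℝ)
      · simpa [γfam', Xnf] using hs (α - a * c₁ - b * c₂) r t
      · simpa [γfam', Xnf] using hc (α - a * c₁ - b * c₂) r t
    · simp only [γfam', mul_add, mul_div_cancel₀ _ hω, Real.sin_add_two_pi, Real.cos_add_two_pi]
  · have h : ContinuousAt (fun p : ℝ × ℝ => 2 * π / (α - a * p.1 - b * p.2)) 0 := by
      apply ContinuousAt.div
      · fun_prop
      · fun_prop
      · simpa using hα.ne'
    simpa [ContinuousAt] using h
  · intro t
    have h : Continuous (fun p : ℝ × ℝ × ℝ => γfam a b α p.1 p.2.1 p.2.2 t) := by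
      refine continuous_pi fun i => ?_
      fin_cases i <;> simp [γfam] <;> fun_prop
    have h0 : γfam a b α 0 0 0 t = 0 := by
      ext i
      fin_cases i <;> simp [γfam]
    simpa [h0] using h.tendsto 0
  · intro t
    have h : Continuous (fun p : ℝ × ℝ × ℝ => γfam' a b α p.1 p.2.1 p.2.2 t) := by
      refine continuous_pi fun i => ?_
      fin_cases i <;> simp [γfam'] <;> fun_prop
    have h0 : γfam' a b α 0 0 0 t = 0 := by
      ext i
      fin_cases i <;> simp [γfam']
    simpa [h0] using h.tendsto 0
end
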